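/- arXiv:2110.14423 — 3 statements merged into one kernel-verified Lean document; each statement's English description precedes it below -/
import Mathlib

section
/- Let V be a finite-dimensional real normed vector space, μ ∈ V, and k : V* × V* → ℝ a symmetric positive semi-definite bilinear form on the dual space. Then there exists a Borel probability measure π on V such that for every continuous linear functional φ : V → ℝ, the pushforward φ∗π is a (possibly degenerate) Gaussian distribution on ℝ with mean φ(μ) and variance k(φ, φ), and moreover Cov of the pair (φ, ψ) under π equals k(φ, ψ) for all φ, ψ ∈ V*. -/
open MeasureTheory ProbabilityTheory

theorem exists_gaussian_measure_of_mean_and_covariance_form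
    {V : Type*} [NormedAddCommGroup V] [NormedSpace ℝ V] [FiniteDimensional ℝ V]
    [MeasurableSpace V] [BorelSpace V]
    (μ : V) (k : (V →L[ℝ] ℝ) → (V →L[ℝ] ℝ) → ℝ)
    (hsymm : ∀ φ ψ, k φ ψ = k ψ φ)
    (hbilin : ∀ (φ₁ φ₂ ψ : V →L[ℝ] ℝ) (a b : ℝ),
      k (a • φ₁ + b • φ₂) ψ = a * k φ₁ ψ + b * k φ₂ ψ)
    (hpsd : ∀ φ, 0 ≤ k φ φ) :
    ∃ π : Measure V, IsProbabilityMeasure π ∧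
      (∀ φ : V →L[ℝ] ℝ, π.map φ = gaussianReal (φ μ) (k φ φ).toNNReal) ∧
      (∀ φ ψ : V →L[ℝ] ℝ, ∫ x, (φ x - φ μ) * (ψ x - ψ μ) ∂π = k φ ψ) := by
  classical
  let ι := Fin (Module.finrank ℝ V)
  let e : V ≃L[ℝ] EuclideanSpace ℝ ι := toEuclidean
  let c : ι → (V →L[ℝ] ℝ) := fun i =>
    (EuclideanSpace.proj i : EuclideanSpace ℝ ι →L[ℝ] ℝ).comp (e : V →L[ℝ] EuclideanSpace ℝ ι)
  have hzero : ∀ ψ, k 0 ψ = 0 := fun ψ => by simpa using hbilin 0 0 ψ 0 0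
  have hsumL : ∀ (s : Finset ι) (w : ι → ℝ) (ψ : V →L[ℝ] ℝ),
      k (∑ i ∈ s, w i • c i) ψ = ∑ i ∈ s, w i * k (c i) ψ := by
    intro s w ψ
    induction s using Finset.induction_on with
    | empty => simpa using hzero ψ
    | insert i s hi ih =>
      rw [Finset.sum_insert hi, Finset.sum_insert hi, ← ih]
      simpa using hbilin (c i) (∑ i ∈ s, w i • c i) ψ (w i) 1
  let S : Matrix ι ι ℝ := Matrix.of fun i j => k (c i) (c j)
  have hS2 : ∀ w v : ι → ℝ, w ⬝ᵥ (S.mulVec v) = k (∑ i, w i • c i) (∑ j, v j • c j) := by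
    intro w v
    rw [hsumL]
    refine Finset.sum_congr rfl fun i _ => ?_
    rw [hsymm, hsumL]
    refine congrArg (fun t => w i * t) ?_
    change ∑ j, S i j * v j = _
    refine Finset.sum_congr rfl fun j _ => ?_
    simp only [S, Matrix.of_apply]
    rw [hsymm, mul_comm]
  have hS : S.PosSemidef := by
    refine Matrix.PosSemidef.of_dotProduct_mulVec_nonneg ?_ fun w => ?_
    · ext i j
      simp [S, hsymm (c j) (c i)]
    · rw [star_trivial, hS2]
      exact hpsd _
  let a : (V →L[ℝ] ℝ) → EuclideanSpace ℝ ι := fun φ =>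
    WithLp.toLp 2 fun i => φ (e.symm (EuclideanSpace.basisFun ι ℝ i))
  have hL : ∀ (φ : V →L[ℝ] ℝ) (x : EuclideanSpace ℝ ι), φ (e.symm x) = inner ℝ (a φ) x := by
    intro φ x
    conv_lhs => rw [← (EuclideanSpace.basisFun ι ℝ).sum_repr x]
    simp [a, PiLp.inner_apply]
  have hφ : ∀ φ : V →L[ℝ] ℝ, φ = ∑ i, (a φ) i • c i := by
    intro φ
    ext x
    have := hL φ (e x)
    rw [e.symm_apply_apply] at this
    rw [this]
    simp [c, PiLp.inner_apply, mul_comm]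
  let ν := multivariateGaussian (e μ) S
  have hmean : ∀ φ : V →L[ℝ] ℝ, ∫ x, φ (e.symm x) ∂ν = φ μ := by
    intro φ
    have h := (φ.comp (e.symm : EuclideanSpace ℝ ι →L[ℝ] V)).integral_comp_comm
      (IsGaussian.integrable_fun_id (μ := ν))
    simp only [ν, integral_id_multivariateGaussian] at h
    simpa using h
  have hcov : ∀ φ ψ : V →L[ℝ] ℝ,
      cov[fun x => φ (e.symm x), fun x => ψ (e.symm x); ν] = k φ ψ := by
    intro φ ψ
    simp_rw [hL]
    rw [← covarianceBilin_apply_eq_cov IsGaussian.memLp_two_id,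
      covarianceBilin_multivariateGaussian hS, hS2, ← hφ, ← hφ]
  have hme : Measurable e.symm := e.symm.continuous.measurable
  refine ⟨ν.map e.symm, Measure.isProbabilityMeasure_map hme.aemeasurable, fun φ => ?_,
    fun φ ψ => ?_⟩
  · rw [Measure.map_map φ.continuous.measurable hme]
    have h := IsGaussian.map_eq_gaussianReal (μ := ν)
      (φ.comp (e.symm : EuclideanSpace ℝ ι →L[ℝ] V))
    have hv : Var[fun x => φ (e.symm x); ν] = k φ φ := by
      rw [← hcov φ φ]
      exact (covariance_self (φ.continuous.measurable.comp hme).aemeasurable).symm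
    have h2 : ν.map (fun x => φ (e.symm x)) =
        gaussianReal (∫ x, φ (e.symm x) ∂ν) (Var[fun x => φ (e.symm x); ν]).toNNReal := h
    rw [hmean, hv] at h2
    exact h2
  · rw [integral_map hme.aemeasurable (by
      apply Continuous.aestronglyMeasurable; fun_prop), ← hcov φ ψ, covariance]
    simp only [hmean]
end

section
/- Let X be a set, (V_x)_{x∈X} a family of finite-dimensional real normed vector spaces, μ a choice of vector μ(x) ∈ V_x for each x, and k a cross-covariance kernel on the family (symmetric, fiberwise bilinear, positive semi-definite on covectors). For each finite subset S = {x₁, …, xₙ} ⊆ X, let π_S be the Gaussian measure (in the sense of duality) on V_{x₁} × ⋯ × V_{xₙ} with mean (μ(x₁), …, μ(xₙ)) and covariance form k_S(α, β) = Σᵢ Σⱼ k(α_{xᵢ}, β_{xⱼ}) for α = (α_{x₁}, …, α_{xₙ}), β = (β_{x₁}, …, β_{xₙ}) in the product of the dual spaces. Then the family (π_S) is projective: whenever T ⊆ S are finite subsets of X, the pushforward of π_S under the canonical projection V_S → V_T equals π_T. -/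
open MeasureTheory ProbabilityTheory

/-- The covariance of two real random variables. -/
noncomputable def cov {Ω : Type*} [MeasurableSpace Ω] (P : Measure Ω) (f g : Ω → ℝ) : ℝ :=
  ∫ ω, (f ω - ∫ ω', f ω' ∂P) * (g ω - ∫ ω', g ω' ∂P) ∂P

theorem gaussian_finite_dimensional_marginals_are_projective
    {X : Type*} (V : X → Type*)
    [∀ x, NormedAddCommGroup (V x)] [∀ x, NormedSpace ℝ (V x)]
    [∀ x, FiniteDimensional ℝ (V x)]
    [∀ x, MeasurableSpace (V x)] [∀ x, BorelSpace (V x)]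
    (μ : ∀ x, V x)
    (k : ∀ x x', (V x →L[ℝ] ℝ) → (V x' →L[ℝ] ℝ) → ℝ)
    (hsymm : ∀ (x x' : X) (φ : V x →L[ℝ] ℝ) (ψ : V x' →L[ℝ] ℝ), k x x' φ ψ = k x' x ψ φ)
    (hbilin : ∀ (x x' : X) (φ₁ φ₂ : V x →L[ℝ] ℝ) (ψ : V x' →L[ℝ] ℝ) (a b : ℝ),
      k x x' (a • φ₁ + b • φ₂) ψ = a * k x x' φ₁ ψ + b * k x x' φ₂ ψ)
    (hpsd : ∀ (n : ℕ) (x : Fin n → X) (α : ∀ i, V (x i) →L[ℝ] ℝ),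
      0 ≤ ∑ i, ∑ j, k (x i) (x j) (α i) (α j))
    (π : ∀ S : Finset X, Measure (∀ x : S, V x))
    (hprob : ∀ S, IsProbabilityMeasure (π S))
    (hgauss : ∀ (S : Finset X) (L : (∀ x : S, V x) →L[ℝ] ℝ),
      ∃ (m : ℝ) (s : NNReal), (π S).map L = gaussianReal m s)
    (hmean : ∀ (S : Finset X) (L : (∀ x : S, V x) →L[ℝ] ℝ),
      ∫ z, L z ∂(π S) = L (fun x => μ x))
    (hcov : ∀ (S : Finset X) (α β : ∀ x : S, V x →L[ℝ] ℝ),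
      cov (π S) (fun z => ∑ x, α x (z x)) (fun z => ∑ x, β x (z x)) =
        ∑ x : S, ∑ x' : S, k x.1 x'.1 (α x) (β x')) :
    ∀ (S T : Finset X) (hTS : T ⊆ S),
      (π S).map (fun z (x : T) => z ⟨x.1, hTS x.2⟩) = π T := by
  classical
  intro S T hTS
  have hG : ∀ S, IsGaussian (π S) := fun S => isGaussian_of_map_eq_gaussianReal (hgauss S)
  have hk0 : ∀ (x x' : X) (ψ : V x' →L[ℝ] ℝ), k x x' 0 ψ = 0 := by
    intro x x' ψ
    simpa using hbilin x x' 0 0 ψ 0 0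
  have hk0' : ∀ (x x' : X) (φ : V x →L[ℝ] ℝ), k x x' φ 0 = 0 := by
    intro x x' φ
    rw [hsymm, hk0]
  have hvar : ∀ (S : Finset X) (L : (∀ x : S, V x) →L[ℝ] ℝ),
      Var[L; π S] = ∑ x : S, ∑ x' : S, k x.1 x'.1
        (L.comp (ContinuousLinearMap.single ℝ (fun x : S => V x) x))
        (L.comp (ContinuousLinearMap.single ℝ (fun x : S => V x) x')) := by
    intro S L
    have hL : (fun z : (∀ x : S, V x) => ∑ x : S,
        (L.comp (ContinuousLinearMap.single ℝ (fun x : S => V x) x)) (z x)) = L := by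
      funext z
      simp only [ContinuousLinearMap.comp_apply, ContinuousLinearMap.single_apply]
      rw [← map_sum, Finset.univ_sum_single]
    rw [← hcov, hL, variance_eq_integral (by fun_prop)]
    simp only [cov, sq]
  let p : (∀ x : S, V x) →L[ℝ] (∀ x : T, V x) :=
    ContinuousLinearMap.pi fun x : T =>
      ContinuousLinearMap.proj (R := ℝ) (φ := fun x : S => V x) ⟨x.1, hTS x.2⟩
  change (π S).map p = π T
  have := hprob S
  have := hprob T
  have : IsProbabilityMeasure ((π S).map p) :=
    Measure.isProbabilityMeasure_map (by fun_prop)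
  apply Measure.ext_of_charFunDual
  funext L
  rw [charFunDual_map, (hG S).charFunDual_eq, (hG T).charFunDual_eq, integral_complex_ofReal,
    integral_complex_ofReal, hmean, hmean, hvar, hvar]
  have hz : ∀ i : S, i ∉ Set.range (fun x : T => (⟨x.1, hTS x.2⟩ : S)) →
      (L.comp p).comp (ContinuousLinearMap.single ℝ (fun x : S => V x) i) = 0 := by
    intro i hi
    ext v
    have : p (Pi.single i v) = 0 := by
      funext x
      change (Pi.single i v : ∀ x : S, V x) ⟨x.1, hTS x.2⟩ = 0
      apply Pi.single_eq_of_ne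
      rintro rfl
      exact hi ⟨x, rfl⟩
    simp [this]
  have hs : ∀ x : T, (L.comp p).comp
        (ContinuousLinearMap.single ℝ (fun x : S => V x) ⟨x.1, hTS x.2⟩) =
      L.comp (ContinuousLinearMap.single ℝ (fun x : T => V x) x) := by
    intro x
    ext v
    have : p (Pi.single (⟨x.1, hTS x.2⟩ : S) v) = (Pi.single x v : ∀ x : T, V x) := by
      funext y
      change (Pi.single _ v : ∀ x : S, V x) ⟨y.1, hTS y.2⟩ = _
      by_cases h : y = x
      · subst h
        rw [Pi.single_eq_same]
        exact (Pi.single_eq_same (M := fun x : T => V x) _ v).symm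
      · rw [Pi.single_eq_of_ne h]
        apply Pi.single_eq_of_ne
        intro h'
        exact h (Subtype.ext (congrArg (fun a : S => a.1) h'))
    simp [this]
  have hinj : Function.Injective (fun x : T => (⟨x.1, hTS x.2⟩ : S)) := by
    intro a b h
    exact Subtype.ext (congrArg (fun a : S => a.1) h)
  have hsum : (∑ x : T, ∑ x' : T, k x.1 x'.1
        (L.comp (ContinuousLinearMap.single ℝ (fun x : T => V x) x))
        (L.comp (ContinuousLinearMap.single ℝ (fun x : T => V x) x'))) =
      ∑ x : S, ∑ x' : S, k x.1 x'.1
        ((L.comp p).comp (ContinuousLinearMap.single ℝ (fun x : S => V x) x))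
        ((L.comp p).comp (ContinuousLinearMap.single ℝ (fun x : S => V x) x')) := by
    apply Fintype.sum_of_injective _ hinj
    · intro i hi
      apply Finset.sum_eq_zero
      intro j _
      rw [hz i hi, hk0]
    · intro i
      apply Fintype.sum_of_injective _ hinj
      · intro j hj
        rw [hz j hj, hk0']
      · intro j
        rw [hs, hs]
  rw [hsum]
  rfl
end

section
/- Let X be a set, (V_x)_{x∈X} a family of finite-dimensional real normed vector spaces, μ a choice of vector μ(x) ∈ V_x for each x, and k a cross-covariance kernel on the family. For each finite subset S ⊆ X let π_S denote the Gaussian measure on ∏_{x∈S} V_x with mean (μ(x))_{x∈S} and covariance form k_S(α, β) = Σ_{x,x'∈S} k(α_x, β_{x'}). Then there exists a unique probability measure π on the product space ∏_{x∈X} V_x (with the product σ-algebra) such that for every finite S ⊆ X, the pushforward of π under the restriction map ∏_{x∈X} V_x → ∏_{x∈S} V_x equals π_S. -/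
open MeasureTheory ProbabilityTheory

open Filter Topology in
/-- A decreasing sequence of cylinders with empty intersection has content tending to zero. -/
theorem kolm_tendsto_zero {ι : Type*} {α : ι → Type*} [∀ i, TopologicalSpace (α i)]
    [∀ i, PolishSpace (α i)] [∀ i, MeasurableSpace (α i)] [∀ i, BorelSpace (α i)]
    {P : ∀ J : Finset ι, Measure (∀ j : J, α j)} [∀ J, IsProbabilityMeasure (P J)]
    (hP : IsProjectiveMeasureFamily P)
    {A : ℕ → Set (∀ i, α i)} (A_mem : ∀ n, A n ∈ measurableCylinders α)
    (A_anti : Antitone A) (A_inter : ⋂ n, A n = ∅) :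
    Tendsto (fun n ↦ projectiveFamilyContent hP (A n)) atTop (𝓝 0) := by
  have h_anti : Antitone (fun n ↦ projectiveFamilyContent hP (A n)) := fun m n hmn ↦
    projectiveFamilyContent_mono hP (A_mem n) (A_mem m) (A_anti hmn)
  have hlim := tendsto_atTop_iInf h_anti
  by_cases h0 : (⨅ n, projectiveFamilyContent hP (A n)) = 0
  · rwa [h0] at hlim
  exfalso
  set ε := ⨅ n, projectiveFamilyContent hP (A n) with hε
  have hεle n : ε ≤ projectiveFamilyContent hP (A n) := iInf_le _ n
  have A_cyl n : ∃ s S, MeasurableSet S ∧ A n = cylinder s S :=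
    (mem_measurableCylinders _).1 (A_mem n)
  choose s S mS A_eq using A_cyl
  obtain ⟨δ, hδpos, hδ⟩ := ENNReal.exists_pos_sum_of_countable' h0 ℕ
  have hK n : ∃ K ⊆ S n, IsCompact K ∧ P (s n) (S n \ K) < δ n :=
    (mS n).exists_isCompact_sdiff_lt (measure_ne_top _ _) (hδpos n).ne'
  choose K hKS hKc hKδ using hK
  have mK n : MeasurableSet (K n) := (hKc n).isClosed.measurableSet
  let C n : Set (∀ i, α i) := cylinder (s n) (K n)
  have C_mem n : C n ∈ measurableCylinders α := cylinder_mem_measurableCylinders _ _ (mK n)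
  have AC_mem n : A n \ C n ∈ measurableCylinders α :=
    sdiff_mem_measurableCylinders (A_mem n) (C_mem n)
  have AC_le n : projectiveFamilyContent hP (A n \ C n) ≤ δ n := by
    rw [projectiveFamilyContent_congr hP (I := s n) (S := S n \ K n) _ _ ((mS n).diff (mK n))]
    · exact (hKδ n).le
    · rw [A_eq]; rfl
  have hne n : ∃ x, ∀ i ≤ n, x ∈ C i := by
    by_contra! hcon
    have hsub : A n ⊆ ⋃ i ≤ n, A i \ C i := by
      intro x hx
      obtain ⟨i, hi, hxi⟩ := hcon x
      exact Set.mem_iUnion₂.2 ⟨i, hi, A_anti hi hx, hxi⟩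
    have hU : (⋃ i ≤ n, A i \ C i) ∈ measurableCylinders α := by
      have : (⋃ i ≤ n, A i \ C i) = ⋃ i ∈ Finset.range (n + 1), A i \ C i := by
        simp only [Finset.mem_range_succ_iff]
      rw [this]
      exact isSetRing_measurableCylinders.biUnion_mem _ fun i _ ↦ AC_mem i
    have := calc ε ≤ projectiveFamilyContent hP (A n) := hεle n
      _ ≤ projectiveFamilyContent hP (⋃ i ≤ n, A i \ C i) :=
        projectiveFamilyContent_mono hP (A_mem n) hU hsub
      _ ≤ ∑ i ∈ Finset.range (n + 1), projectiveFamilyContent hP (A i \ C i) :=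
        projectiveFamilyContent_iUnion_le hP AC_mem n
      _ ≤ ∑ i ∈ Finset.range (n + 1), δ i := Finset.sum_le_sum fun i _ ↦ AC_le i
      _ ≤ ∑' i, δ i := ENNReal.sum_le_tsum _
      _ < ε := hδ
    exact lt_irrefl _ this
  choose x hx using hne
  have hev k : ∀ᶠ n in (hyperfilter ℕ : Filter ℕ), (s k).restrict (x n) ∈ K k := by
    have : ∀ᶠ n in (atTop : Filter ℕ), (s k).restrict (x n) ∈ K k :=
      (eventually_ge_atTop k).mono fun n hn ↦ hx n k hn
    exact Nat.hyperfilter_le_atTop this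
  have hz i : ∃ z : α i, (∃ k, i ∈ s k) →
      Tendsto (fun n ↦ x n i) (hyperfilter ℕ : Filter ℕ) (𝓝 z) := by
    by_cases hi : ∃ k, i ∈ s k
    · obtain ⟨k, hk⟩ := hi
      have hc : IsCompact ((fun y : (∀ j : s k, α j) ↦ y ⟨i, hk⟩) '' K k) :=
        (hKc k).image (continuous_apply _)
      obtain ⟨z, -, hz⟩ := hc.ultrafilter_le_nhds ((hyperfilter ℕ).map fun n ↦ x n i) (by
        rw [le_principal_iff]
        exact (hev k).mono fun n hn ↦ ⟨_, hn, rfl⟩)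
      exact ⟨z, fun _ ↦ hz⟩
    · exact ⟨x 0 i, fun h ↦ absurd h hi⟩
  choose z hz using hz
  have : z ∈ ⋂ n, A n := by
    refine Set.mem_iInter.2 fun k ↦ ?_
    rw [A_eq]
    refine hKS k ?_
    refine (hKc k).isClosed.mem_of_tendsto (f := fun n ↦ (s k).restrict (x n))
      (b := (hyperfilter ℕ : Filter ℕ)) ?_ (hev k)
    exact tendsto_pi_nhds.2 fun i ↦ hz i ⟨k, i.2⟩
  rw [A_inter] at this
  exact this

/-- Kolmogorov extension theorem for Polish spaces. -/
theorem kolm_exists {ι : Type*} {α : ι → Type*} [∀ i, TopologicalSpace (α i)]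
    [∀ i, PolishSpace (α i)] [∀ i, MeasurableSpace (α i)] [∀ i, BorelSpace (α i)]
    {P : ∀ J : Finset ι, Measure (∀ j : J, α j)} [∀ J, IsProbabilityMeasure (P J)]
    (hP : IsProjectiveMeasureFamily P) : ∃ μ : Measure (∀ i, α i), IsProjectiveLimit μ P := by
  have hσ : (projectiveFamilyContent hP).IsSigmaSubadditive := by
    refine isSigmaSubadditive_of_addContent_iUnion_eq_tsum
      isSetRing_measurableCylinders (fun f hf hf_Union hf' ↦ ?_)
    exact addContent_iUnion_eq_sum_of_tendsto_zero isSetRing_measurableCylinders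
      (projectiveFamilyContent hP) (fun s hs ↦ projectiveFamilyContent_ne_top _)
      (fun _ ↦ kolm_tendsto_zero hP) hf hf_Union hf'
  refine ⟨(projectiveFamilyContent hP).measure isSetSemiring_measurableCylinders
      generateFrom_measurableCylinders.ge hσ, fun I ↦ ?_⟩
  ext s hs
  rw [Measure.map_apply (Finset.measurable_restrict I) hs, AddContent.measure_eq,
    ← cylinder, projectiveFamilyContent_cylinder hP hs]
  · exact generateFrom_measurableCylinders.symm
  · exact cylinder_mem_measurableCylinders _ _ hs


theorem exists_unique_gaussian_process_measure_extending_marginals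
    {X : Type*} (V : X → Type*)
    [∀ x, NormedAddCommGroup (V x)] [∀ x, NormedSpace ℝ (V x)]
    [∀ x, FiniteDimensional ℝ (V x)]
    [∀ x, MeasurableSpace (V x)] [∀ x, BorelSpace (V x)]
    (μ : ∀ x, V x)
    (k : ∀ x x', (V x →L[ℝ] ℝ) → (V x' →L[ℝ] ℝ) → ℝ)
    (hsymm : ∀ (x x' : X) (φ : V x →L[ℝ] ℝ) (ψ : V x' →L[ℝ] ℝ), k x x' φ ψ = k x' x ψ φ)
    (hbilin : ∀ (x x' : X) (φ₁ φ₂ : V x →L[ℝ] ℝ) (ψ : V x' →L[ℝ] ℝ) (a b : ℝ),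
      k x x' (a • φ₁ + b • φ₂) ψ = a * k x x' φ₁ ψ + b * k x x' φ₂ ψ)
    (hpsd : ∀ (n : ℕ) (x : Fin n → X) (α : ∀ i, V (x i) →L[ℝ] ℝ),
      0 ≤ ∑ i, ∑ j, k (x i) (x j) (α i) (α j))
    (π : ∀ S : Finset X, Measure (∀ x : S, V x))
    (hprob : ∀ S, IsProbabilityMeasure (π S))
    (hgauss : ∀ (S : Finset X) (L : (∀ x : S, V x) →L[ℝ] ℝ),
      ∃ (m : ℝ) (s : NNReal), (π S).map L = gaussianReal m s)
    (hmean : ∀ (S : Finset X) (L : (∀ x : S, V x) →L[ℝ] ℝ),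
      ∫ z, L z ∂(π S) = L (fun x => μ x))
    (hcov : ∀ (S : Finset X) (α β : ∀ x : S, V x →L[ℝ] ℝ),
      cov (π S) (fun z => ∑ x, α x (z x)) (fun z => ∑ x, β x (z x)) =
        ∑ x : S, ∑ x' : S, k x.1 x'.1 (α x) (β x')) :
    ∃! πX : Measure (∀ x, V x), IsProbabilityMeasure πX ∧
      ∀ S : Finset X, πX.map (fun z (x : S) => z x.1) = π S := by

  classical
  have hpol : ∀ x, PolishSpace (V x) := fun x ↦ by
    have := FiniteDimensional.complete ℝ (V x)
    have := FiniteDimensional.proper ℝ (V x)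
    infer_instance
  have hG : ∀ S, IsGaussian (π S) := fun S ↦ isGaussian_of_map_eq_gaussianReal (hgauss S)
  have hk0 : ∀ x x' (ψ : V x' →L[ℝ] ℝ), k x x' 0 ψ = 0 := fun x x' ψ ↦ by
    simpa using hbilin x x' 0 0 ψ 0 0
  have hk0' : ∀ x x' (φ : V x →L[ℝ] ℝ), k x x' φ 0 = 0 := fun x x' φ ↦ by
    rw [hsymm, hk0]
  -- variance of a functional given by a family of covectors
  have hvar : ∀ (S : Finset X) (L : (∀ x : S, V x) →L[ℝ] ℝ) (α : ∀ x, V x →L[ℝ] ℝ),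
      (∀ z, L z = ∑ x : S, α x (z x)) →
      Var[L; π S] = ∑ x ∈ S, ∑ x' ∈ S, k x x' (α x) (α x') := by
    intro S L α hL
    have h := hcov S (fun x ↦ α x) (fun x ↦ α x)
    have hL' : (fun z : (∀ x : S, V x) ↦ ∑ x : S, α x (z x)) = L := by
      funext z; exact (hL z).symm
    rw [hL'] at h
    rw [variance_eq_integral (by fun_prop), ← Finset.sum_coe_sort S]
    simp_rw [← Finset.sum_coe_sort S (fun x' ↦ k _ x' _ (α x'))]
    rw [← h, cov]
    simp_rw [pow_two]
  have hproj : IsProjectiveMeasureFamily π := by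
    intro I J hJI
    let R : (∀ x : I, V x) →L[ℝ] (∀ x : J, V x) :=
      ContinuousLinearMap.pi fun x ↦ ContinuousLinearMap.proj (⟨x.1, hJI x.2⟩ : I)
    change π J = (π I).map R
    have hfin : IsFiniteMeasure ((π I).map R) := inferInstance
    apply Measure.ext_of_charFunDual
    ext L
    rw [charFunDual_map, IsGaussian.charFunDual_eq, IsGaussian.charFunDual_eq]
    let α : ∀ x, V x →L[ℝ] ℝ := fun x ↦
      if h : x ∈ J then L.comp (ContinuousLinearMap.single ℝ (fun x : J ↦ V x) ⟨x, h⟩) else 0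
    have hα0 : ∀ x, x ∉ J → α x = 0 := fun x hx ↦ dif_neg hx
    have h1 : ∀ z, L z = ∑ x : J, α x (z x) := by
      intro z
      conv_lhs => rw [← Finset.univ_sum_single z]
      rw [map_sum]
      refine Finset.sum_congr rfl fun x _ ↦ ?_
      simp [α]
    have h2 : ∀ z, (L.comp R) z = ∑ x : I, α x (z x) := by
      intro z
      let z' : ∀ x, V x := fun x ↦ if h : x ∈ I then z ⟨x, h⟩ else 0
      have hz' : ∀ x : I, z x = z' x := fun x ↦ by simp [z']
      have e1 : ∑ x : I, α x (z x) = ∑ x ∈ I, α x (z' x) := by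
        rw [← Finset.sum_coe_sort I]
        exact Finset.sum_congr rfl fun x _ ↦ by rw [hz']
      have e2 : (L.comp R) z = ∑ x ∈ J, α x (z' x) := by
        rw [← Finset.sum_coe_sort J, ContinuousLinearMap.comp_apply, h1]
        refine Finset.sum_congr rfl fun x _ ↦ ?_
        congr 1
        exact hz' ⟨x.1, hJI x.2⟩
      rw [e1, e2]
      refine Finset.sum_subset hJI fun x _ hx ↦ ?_
      rw [hα0 x hx]; rfl
    have hv : Var[L; π J] = Var[L.comp R; π I] := by
      rw [hvar J L α h1, hvar I (L.comp R) α h2]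
      rw [← Finset.sum_subset hJI]
      · refine Finset.sum_congr rfl fun x _ ↦ Finset.sum_subset hJI fun x' _ hx' ↦ ?_
        rw [hα0 x' hx', hk0']
      · intro x _ hx
        refine Finset.sum_eq_zero fun x' _ ↦ ?_
        rw [hα0 x hx, hk0]
    have hm : ∫ z, L z ∂(π J) = ∫ z, (L.comp R) z ∂(π I) := by
      rw [hmean J L, hmean I (L.comp R)]; rfl
    rw [hv, integral_complex_ofReal, integral_complex_ofReal, hm]
  obtain ⟨ν, hν⟩ := kolm_exists hproj
  refine ⟨ν, ⟨hν.isProbabilityMeasure, fun S ↦ hν S⟩, ?_⟩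
  rintro ν' ⟨-, h'⟩
  exact IsProjectiveLimit.unique (P := π) (fun S ↦ h' S) hν
end
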